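/- arXiv:2301.05313 — 5 statements merged into one kernel-verified Lean document; each statement's English description precedes it below -/
import Mathlib

section
/- Let q be a prime power and let b be a positive integer, and let d be a natural number with 0 < d < b. Then every weighted-homogeneous polynomial F ∈ S_d (weights deg x₁ = deg x₂ = 1, deg x₃ = b) whose evaluation vector (F(P))_{P ∈ T} is nonzero satisfies |{P ∈ T : F(P) ≠ 0}| ≥ q. In particular, the minimum distance of the code C_{d,Y} is at least q. -/
open MvPolynomial

noncomputable section

variable (F : Type) [Field F] [Fintype F]

/-- The submodule of polynomials vanishing at every nonzero point of `F³`. -/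
def vanishing : Submodule F (MvPolynomial (Fin 3) F) where
  carrier := {f | ∀ y : Fin 3 → F, y ≠ 0 → eval y f = 0}
  add_mem' := fun hf hg y hy => by simp [hf y hy, hg y hy]
  zero_mem' := fun y hy => by simp
  smul_mem' := fun c f hf y hy => by simp [MvPolynomial.smul_eval, hf y hy]

/-- `S_d`: the degree-`d` weighted-homogeneous piece (weights `1, 1, b`). -/
def Sd (b d : ℕ) : Submodule F (MvPolynomial (Fin 3) F) :=
  weightedHomogeneousSubmodule F ![1, 1, b] d

/-- `I_d`: the degree-`d` piece of the vanishing ideal of `ℙ(1,1,b)(F_q)`. -/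
def Id' (b d : ℕ) : Submodule F (MvPolynomial (Fin 3) F) := Sd F b d ⊓ vanishing F

/-- The Hilbert function `H_Y(d) = dim S_d − dim I_d` of `Y = ℙ(1,1,b)(F_q)`. -/
def HY (b d : ℕ) : ℕ :=
  Module.finrank F ↥(Sd F b d) - Module.finrank F ↥(Id' F b d)

/-- `T`: the standard representatives of the `q²+q+1` rational points of `ℙ(1,1,b)`:
`{(1,y₂,y₃)} ∪ {(0,y₂,1)} ∪ {(0,1,0)}`. -/
def T : Set (Fin 3 → F) :=
  {y | y 0 = 1} ∪ {y | y 0 = 0 ∧ y 2 = 1} ∪ {![0, 1, 0]}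

/-- The evaluation map `S → F^T`. -/
def evalT : MvPolynomial (Fin 3) F →ₗ[F] (T F → F) :=
  LinearMap.pi fun P => (aeval (P : Fin 3 → F)).toLinearMap

/-- The weighted projective Reed–Muller code `C_{d,Y}`, the image of `S_d` under the
evaluation map at the points of `T`. -/
def code (b d : ℕ) : Submodule F (T F → F) := (Sd F b d).map (evalT F)

theorem eval_scale_aux (b d : ℕ) (hdb : d < b) (f : MvPolynomial (Fin 3) F)
    (hf : IsWeightedHomogeneous ![1, 1, b] f d) (P Q : Fin 3 → F) (y : F)
    (h0 : P 0 = y * Q 0) (h1 : P 1 = y * Q 1) : eval P f = y ^ d * eval Q f := by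
  rw [eval_eq', eval_eq', Finset.mul_sum]
  refine Finset.sum_congr rfl fun m hm => ?_
  have hw := hf (mem_support_iff.mp hm)
  rw [Finsupp.weight_apply, Finsupp.sum_fintype _ _ (by simp)] at hw
  simp only [Fin.sum_univ_three, smul_eq_mul] at hw
  simp at hw
  have h2 : m 2 = 0 := by
    by_contra h
    have : b ≤ m 2 * b := Nat.le_mul_of_pos_left b (Nat.pos_of_ne_zero h)
    omega
  rw [h2] at hw
  simp only [Fin.prod_univ_three, h0, h1, h2, pow_zero, mul_one]
  have : d = m 0 + m 1 := by omega
  rw [this]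
  ring

/-- Theorem (Lemma on minimum distance for `0 < d < b`): every weighted-homogeneous
`F ∈ S_d` with nonzero evaluation vector on `T` has at least `q` nonzero evaluations;
in particular the minimum distance of `C_{d,Y}` is at least `q`. -/
theorem min_distance_lower_bound_P11b (q : ℕ) (hq : q = Fintype.card F)
    (b : ℕ) (hb : 0 < b) (d : ℕ) (hd0 : 0 < d) (hdb : d < b) :
    ∀ f : MvPolynomial (Fin 3) F, IsWeightedHomogeneous ![1, 1, b] f d →
      (∃ P ∈ T F, eval P f ≠ 0) →
      q ≤ {P ∈ T F | eval P f ≠ 0}.ncard := by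
  intro f hf ⟨P, hP, hne⟩
  have key : ∀ g : F → (Fin 3 → F), Function.Injective g →
      (∀ z, g z ∈ {P ∈ T F | eval P f ≠ 0}) → q ≤ {P ∈ T F | eval P f ≠ 0}.ncard := by
    intro g hg hgm
    have h1 : (Set.range g).ncard = q := by
      rw [← Set.image_univ, Set.ncard_image_of_injective _ hg, Set.ncard_univ,
        Nat.card_eq_fintype_card, hq]
    rw [← h1]
    exact Set.ncard_le_ncard (by rintro _ ⟨z, rfl⟩; exact hgm z) (Set.toFinite _)
  by_cases hP0 : P 0 = 0
  · have hs := eval_scale_aux F b d hdb f hf P ![0, 1, 0] (P 1) (by simp [hP0]) (by simp)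
    have hc : eval ![0, 1, 0] f ≠ 0 := by
      intro h
      rw [h, mul_zero] at hs
      exact hne hs
    classical
    refine key (fun y => if y = 0 then ![0, 1, 0] else ![0, y, 1]) ?_ ?_
    · intro y y' h
      have e1 := congrFun h 1
      have e2 := congrFun h 2
      by_cases hy : y = 0 <;> by_cases hy' : y' = 0 <;> simp_all
    · intro y
      by_cases hy : y = 0
      · simp only [hy, if_true]
        exact ⟨Or.inr rfl, hc⟩
      · simp only [hy, if_false]
        refine ⟨Or.inl (Or.inr ⟨by simp, by simp⟩), ?_⟩
        rw [eval_scale_aux F b d hdb f hf ![0, y, 1] ![0, 1, 0] y (by simp) (by simp)]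
        exact mul_ne_zero (pow_ne_zero _ hy) hc
  · have hP1 : P 0 = 1 := by
      rcases hP with (h | h) | h
      · exact h
      · exact absurd h.1 hP0
      · rw [Set.mem_singleton_iff] at h
        exact absurd (by simp [h]) hP0
    refine key (fun z => ![1, P 1, z]) ?_ ?_
    · intro z z' h
      simpa using congrFun h 2
    · intro z
      refine ⟨Or.inl (Or.inl (by simp)), ?_⟩
      rw [eval_scale_aux F b d hdb f hf ![1, P 1, z] P 1 (by simp [hP1]) (by simp)]
      simpa using hne

end
end

section
/- Let q be a prime power and let b be a positive integer, and let d be a natural number with q ≤ d < b. Then the minimum distance of the code C_{d,Y} on Y = P(1,1,b)(F_q) equals q; that is, the minimum of |{P ∈ T : F(P) ≠ 0}| over all weighted-homogeneous F ∈ S_d with nonzero evaluation vector (F(P))_{P ∈ T} is exactly q. -/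
open MvPolynomial

noncomputable section

variable (F : Type) [Field F] [Fintype F]

theorem eval_scale {b d : ℕ} (hdb : d < b) {f : MvPolynomial (Fin 3) F}
    (hf : IsWeightedHomogeneous ![1, 1, b] f d) (t : F) (P Q : Fin 3 → F)
    (h0 : Q 0 = t * P 0) (h1 : Q 1 = t * P 1) : eval Q f = t ^ d * eval P f := by
  rw [eval_eq', eval_eq', Finset.mul_sum]
  refine Finset.sum_congr rfl fun m hm => ?_
  have hw := hf (mem_support_iff.mp hm)
  rw [Finsupp.weight_apply, Finsupp.sum_fintype _ _ (by simp)] at hw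
  simp [Fin.sum_univ_three] at hw
  have h2 : m 2 = 0 := by
    rcases Nat.eq_zero_or_pos (m 2) with h | h
    · exact h
    · have := Nat.le_mul_of_pos_left b h
      omega
  have hd : m 0 + m 1 = d := by simpa [h2] using hw
  simp only [Fin.prod_univ_three, h2, h0, h1, ← hd, pow_zero]
  ring

/-- Theorem (minimum distance of `C_{d,Y}` for `q ≤ d < b`): the minimum of
`|{P ∈ T : F(P) ≠ 0}|` over weighted-homogeneous `F ∈ S_d` with nonzero evaluation
vector is exactly `q`. -/
theorem min_distance_P11b_q_le_d_lt_b (q : ℕ) (hq : q = Fintype.card F)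
    (b : ℕ) (hb : 0 < b) (d : ℕ) (hqd : q ≤ d) (hdb : d < b) :
    IsLeast {n : ℕ | ∃ f : MvPolynomial (Fin 3) F,
        IsWeightedHomogeneous ![1, 1, b] f d ∧ (∃ P ∈ T F, eval P f ≠ 0) ∧
        n = {P ∈ T F | eval P f ≠ 0}.ncard} q := by
  classical
  constructor
  · have hc : 1 < q := hq ▸ Fintype.one_lt_card
    refine ⟨X 0 ^ d - X 0 ^ (d - q + 1) * X 1 ^ (q - 1), ?_, ?_, ?_⟩
    · have e0 : IsWeightedHomogeneous ![1, 1, b] (X 0 : MvPolynomial (Fin 3) F) 1 := by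
        simpa using isWeightedHomogeneous_X F ![1, 1, b] (0 : Fin 3)
      have e1 : IsWeightedHomogeneous ![1, 1, b] (X 1 : MvPolynomial (Fin 3) F) 1 := by
        simpa using isWeightedHomogeneous_X F ![1, 1, b] (1 : Fin 3)
      have a1 := e0.pow d
      have a2 := (e0.pow (d - q + 1)).mul (e1.pow (q - 1))
      have h1 : d • 1 = d := by simp
      have h2 : (d - q + 1) • 1 + (q - 1) • 1 = d := by simp; omega
      rw [h1] at a1
      rw [h2] at a2
      exact (weightedHomogeneousSubmodule F ![1, 1, b] d).sub_mem a1 a2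
    · refine ⟨![1, 0, 0], Or.inl (Or.inl (by simp)), ?_⟩
      have : q - 1 ≠ 0 := by omega
      simp [this]
    · have hs : {P ∈ T F | eval P (X 0 ^ d - X 0 ^ (d - q + 1) * X 1 ^ (q - 1) :
          MvPolynomial (Fin 3) F) ≠ 0} = Set.range (fun c : F => (![1, 0, c] : Fin 3 → F)) := by
        have hq1 : q - 1 ≠ 0 := by omega
        have hd0 : d ≠ 0 := by omega
        ext P
        constructor
        · rintro ⟨hP, h⟩
          simp only [map_sub, map_mul, map_pow, eval_X] at h
          have h0 : P 0 = 1 := by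
            rcases hP with (hP | hP) | hP
            · exact hP
            · exact absurd (by simp [hP.1, hd0]) h
            · rw [Set.mem_singleton_iff] at hP
              exact absurd (by simp [hP, hd0]) h
          have h1 : P 1 = 0 := by
            by_contra hne
            apply h
            rw [h0, hq, FiniteField.pow_card_sub_one_eq_one _ hne]
            simp
          refine ⟨P 2, ?_⟩
          ext i
          fin_cases i <;> simp [h0, h1]
        · rintro ⟨c, rfl⟩
          exact ⟨Or.inl (Or.inl (by simp)), by simp [hq1]⟩
      rw [hs, ← Set.image_univ, Set.ncard_image_of_injective, Set.ncard_univ,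
        Nat.card_eq_fintype_card, hq]
      intro a c h
      simpa using congrFun h 2
  · rintro n ⟨f, hf, ⟨P, hP, hne⟩, rfl⟩
    have key : ∀ g : F → (Fin 3 → F), Function.Injective g →
        (∀ c, g c ∈ {P ∈ T F | eval P f ≠ 0}) → q ≤ {P ∈ T F | eval P f ≠ 0}.ncard := by
      intro g hg hm
      rw [hq, ← Nat.card_eq_fintype_card, ← Set.ncard_univ, ← Set.ncard_image_of_injective _ hg]
      apply Set.ncard_le_ncard _ (Set.toFinite _)
      rintro _ ⟨c, -, rfl⟩
      exact hm c
    by_cases h0 : P 0 = 0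
    · have hz : eval ![0, 1, 0] f ≠ 0 := by
        intro hz
        apply hne
        rw [eval_scale F hdb hf (P 1) ![0, 1, 0] P (by simp [h0]) (by simp), hz, mul_zero]
      refine key (fun c => if c = 0 then ![0, 1, 0] else ![0, c, 1]) ?_ ?_
      · intro a c h
        have e1 := congrFun h 1
        have e2 := congrFun h 2
        by_cases ha : a = 0 <;> by_cases hc : c = 0 <;> simp_all
      · intro c
        by_cases hc : c = 0
        · simp only [hc, if_true]
          exact ⟨Or.inr rfl, hz⟩
        · simp only [hc, if_false]
          refine ⟨Or.inl (Or.inr (by simp)), ?_⟩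
          rw [eval_scale F hdb hf c ![0, 1, 0] ![0, c, 1] (by simp) (by simp)]
          exact mul_ne_zero (pow_ne_zero _ hc) hz
    · have h1 : P 0 = 1 := by
        rcases hP with (hP | hP) | hP
        · exact hP
        · exact absurd hP.1 h0
        · rw [Set.mem_singleton_iff] at hP
          exact absurd (by simp [hP]) h0
      refine key (fun c => ![1, P 1, c]) ?_ ?_
      · intro a c h
        simpa using congrFun h 2
      · intro c
        refine ⟨Or.inl (Or.inl (by simp)), ?_⟩
        rw [eval_scale F hdb hf 1 P ![1, P 1, c] (by simp [h1]) (by simp)]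
        simpa using hne

end
end

section
/- Let q be a prime power and let b be a positive integer, and let d be a natural number with 0 < d < q. Then the minimum distance of the code C_{d,Y} on Y = P(1,1,b)(F_q) equals q(q − d + 1); that is, the minimum of |{P ∈ T : F(P) ≠ 0}| over all weighted-homogeneous F ∈ S_d with nonzero evaluation vector (F(P))_{P ∈ T} is exactly q(q − d + 1). -/
open MvPolynomial

noncomputable section

variable (F : Type) [Field F] [Fintype F]

theorem aux_arith {q d b J A I : ℕ} (hb : 0 < b) (hdq : d < q) (hbJ : b*J ≤ d)
    (hA : (q-(d-b*J))*(q-J) ≤ A) (hI : q-d+1 ≤ I) (hJ0 : 0 < J) (h : 2 ≤ b ∨ J < d) :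
    q*(q-d+1) ≤ A + I := by
  have hJd : J ≤ d := by nlinarith
  obtain ⟨k, rfl⟩ := Nat.exists_eq_add_of_le hbJ
  obtain ⟨l, rfl⟩ := Nat.exists_eq_add_of_lt hdq
  have h1 : b*J+k+l+1-(b*J+k-b*J) = b*J+l+1 := by omega
  have h2 : b*J+k+l+1-(b*J+k) = l+1 := by omega
  rw [h1] at hA
  rw [h2] at hI ⊢
  obtain ⟨c, rfl⟩ := Nat.exists_eq_add_of_lt hb
  have h3 : (0+c+1)*J+k+l+1-J = c*J+k+l+1 := by
    have : (0+c+1)*J = c*J+J := by ring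
    omega
  rw [h3] at hA
  obtain ⟨j, rfl⟩ := Nat.exists_eq_add_of_lt hJ0
  rcases Nat.eq_zero_or_pos c with rfl | hc
  · have hk : 0 < k := by omega
    obtain ⟨k, rfl⟩ := Nat.exists_eq_add_of_lt hk
    nlinarith [Nat.zero_le (j*k)]
  · obtain ⟨c, rfl⟩ := Nat.exists_eq_add_of_lt hc
    ring_nf at hA hI ⊢
    linarith [Nat.zero_le (j*k), Nat.zero_le (c*j), Nat.zero_le (c*j*k), Nat.zero_le (c*j*l),
      Nat.zero_le (c*j^2), Nat.zero_le (c*k), Nat.zero_le (c*l), Nat.zero_le (c^2),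
      Nat.zero_le (c^2*j), Nat.zero_le (c^2*j^2), Nat.zero_le (j*l), Nat.zero_le (j^2),
      Nat.zero_le (k*l)]

theorem aux_arith1 {q d b J A e : ℕ} (hb : 0 < b) (hdq : d < q) (hbJ : e + b*J + 1 ≤ d)
    (hA : (q-e)*(q-J) ≤ A) : q*(q-d+1) ≤ A := by
  have hJd : J ≤ b*J := by nlinarith
  refine le_trans ?_ hA
  obtain ⟨k, hk⟩ := Nat.exists_eq_add_of_le (show e + J + 1 ≤ d by omega)
  subst hk
  obtain ⟨l, rfl⟩ := Nat.exists_eq_add_of_lt hdq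
  have h1 : e+J+1+k+l+1-e = J+1+k+l+1 := by omega
  have h2 : e+J+1+k+l+1-J = e+1+k+l+1 := by omega
  have h3 : e+J+1+k+l+1-(e+J+1+k) = l+1 := by omega
  rw [h1, h2, h3]
  ring_nf
  linarith [Nat.zero_le (e*J), Nat.zero_le (k*e), Nat.zero_le (k*J), Nat.zero_le (k^2), Nat.zero_le (k*l), Nat.zero_le (e*l), Nat.zero_le (J*l)]

open Classical in
theorem aux_roots (p : Polynomial F) (hp : p ≠ 0) (e : ℕ) (he : p.natDegree ≤ e) :
    Fintype.card F - e ≤ (Finset.univ.filter fun a : F => p.eval a ≠ 0).card := by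
  have h1 : (Finset.univ.filter fun a : F => p.eval a = 0).card ≤ e := by
    refine le_trans ?_ (p.card_roots'.trans he)
    refine le_trans ?_ (Multiset.toFinset_card_le _)
    apply Finset.card_le_card
    intro a ha
    simpa [hp] using ha
  have h2 := Finset.card_filter_add_card_filter_not (s := (Finset.univ : Finset F))
    (fun a : F => p.eval a = 0)
  rw [Finset.card_univ] at h2
  simp only [ne_eq]
  omega

open Classical in
theorem aux_affine (P : ℕ → Polynomial F) (J e : ℕ) (hJ : P J ≠ 0) (he : (P J).natDegree ≤ e) :
    (Fintype.card F - e) * (Fintype.card F - J) ≤ (Finset.univ.filter fun a : F × F =>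
      ∑ j ∈ Finset.range (J+1), (P j).eval a.1 * a.2 ^ j ≠ 0).card := by
  set U := (Finset.univ.filter fun a : F => (P J).eval a ≠ 0)
  have h1 := aux_roots F (P J) hJ e he
  have h2 : U.card * (Fintype.card F - J) ≤ (U.sigma fun a => Finset.univ.filter fun y : F =>
      ∑ j ∈ Finset.range (J+1), (P j).eval a * y ^ j ≠ 0).card := by
    rw [Finset.card_sigma, ← smul_eq_mul]
    apply Finset.card_nsmul_le_sum
    intro a ha
    have ha' : (P J).eval a ≠ 0 := by simpa [U] using ha
    have h3 := aux_roots F (∑ j ∈ Finset.range (J+1), Polynomial.C ((P j).eval a) * Polynomial.X ^ j)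
      (by
        intro h0
        have := congrArg (fun p => Polynomial.coeff p J) h0
        simp [Polynomial.finset_sum_coeff, Polynomial.coeff_C_mul, Polynomial.coeff_X_pow] at this
        exact ha' this) J
      (by
        apply Polynomial.natDegree_sum_le_of_forall_le
        intro j hj
        have : j ≤ J := by simpa [Nat.lt_succ_iff] using hj
        exact (Polynomial.natDegree_C_mul_X_pow_le _ _).trans this)
    simpa [Polynomial.eval_finset_sum] using h3
  refine (Nat.mul_le_mul_right _ h1).trans (h2.trans ?_)
  apply Finset.card_le_card_of_injOn (fun s => (s.1, s.2))
  · rintro ⟨a, y⟩ h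
    simp at h ⊢
    exact h.2
  · rintro ⟨a, y⟩ h ⟨a', y'⟩ h' hh
    simp at hh
    obtain ⟨rfl, rfl⟩ := hh
    rfl

open Classical in
theorem aux_count (f : MvPolynomial (Fin 3) F) :
    {P ∈ T F | eval P f ≠ 0}.ncard =
      (Finset.univ.filter fun a : F × F => eval ![1, a.1, a.2] f ≠ 0).card +
      ((Finset.univ.filter fun a : F => eval ![0, a, 1] f ≠ 0).card +
      (if eval ![0, 1, 0] f ≠ 0 then 1 else 0)) := by
  have h : {P ∈ T F | eval P f ≠ 0} =
      (((Finset.univ.filter fun a : F × F => eval ![1, a.1, a.2] f ≠ 0).image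
        (fun a => ![1, a.1, a.2]) ∪
      ((Finset.univ.filter fun a : F => eval ![0, a, 1] f ≠ 0).image (fun a => ![0, a, 1]) ∪
      (if eval ![0, 1, 0] f ≠ 0 then {![0,1,0]} else ∅)) : Finset (Fin 3 → F)) : Set (Fin 3 → F)) := by
    ext P
    have hP : P = ![P 0, P 1, P 2] := by
      ext i; fin_cases i <;> rfl
    constructor
    · rintro ⟨hT, hne⟩
      rcases hT with (h | ⟨h, h'⟩) | h
      · simp only [Set.mem_setOf_eq] at h
        rw [h] at hP
        simp only [Finset.coe_union, Set.mem_union, Finset.mem_coe, Finset.mem_image]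
        left
        refine ⟨(P 1, P 2), ?_, hP.symm⟩
        simp only [Finset.mem_filter, Finset.mem_univ, true_and]
        rwa [← hP]
      · rw [h, h'] at hP
        simp only [Finset.coe_union, Set.mem_union, Finset.mem_coe, Finset.mem_image]
        right; left
        refine ⟨P 1, ?_, hP.symm⟩
        simp only [Finset.mem_filter, Finset.mem_univ, true_and]
        rwa [← hP]
      · rw [Set.mem_singleton_iff] at h
        subst h
        simp only [Finset.coe_union, Set.mem_union, Finset.mem_coe]
        right; right
        rw [if_pos hne]
        simp
    · intro h
      simp only [Finset.coe_union, Set.mem_union, Finset.mem_coe, Finset.mem_image,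
        Finset.mem_filter, Finset.mem_univ, true_and] at h
      rcases h with ⟨a, ha, rfl⟩ | ⟨a, ha, rfl⟩ | h
      · exact ⟨Or.inl (Or.inl (by simp)), ha⟩
      · exact ⟨Or.inl (Or.inr (by simp)), ha⟩
      · split_ifs at h with h0
        · rw [Finset.mem_singleton] at h
          subst h
          exact ⟨Or.inr rfl, h0⟩
        · simp at h
  rw [h, Set.ncard_coe_finset, Finset.card_union_of_disjoint, Finset.card_union_of_disjoint,
    Finset.card_image_of_injective, Finset.card_image_of_injective]
  · congr 2
    split_ifs <;> simp
  · intro a b hab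
    simpa using congrFun hab 1
  · rintro ⟨a, a'⟩ ⟨b, b'⟩ hab
    have h1 := congrFun hab 1
    have h2 := congrFun hab 2
    simp at h1 h2
    simp [h1, h2]
  · rw [Finset.disjoint_left]
    intro P hP hQ
    simp only [Finset.mem_image] at hP
    obtain ⟨a, -, rfl⟩ := hP
    split_ifs at hQ with h0
    · rw [Finset.mem_singleton] at hQ
      simpa using congrFun hQ 2
    · simp at hQ
  · rw [Finset.disjoint_left]
    intro P hP hQ
    simp only [Finset.mem_image] at hP
    obtain ⟨a, -, rfl⟩ := hP
    simp only [Finset.mem_union, Finset.mem_image] at hQ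
    rcases hQ with ⟨a, -, hQ⟩ | hQ
    · simpa using congrFun hQ 0
    · split_ifs at hQ with h0
      · rw [Finset.mem_singleton] at hQ
        simpa using congrFun hQ 0
      · simp at hQ

def mk3 (a i j : ℕ) : Fin 3 →₀ ℕ := Finsupp.equivFunOnFinite.symm ![a, i, j]

def cf (b d : ℕ) (f : MvPolynomial (Fin 3) F) (i j : ℕ) : F :=
  if i + b * j ≤ d then coeff (mk3 (d - i - b * j) i j) f else 0

theorem aux_supp {b d : ℕ} {f : MvPolynomial (Fin 3) F}
    (hf : IsWeightedHomogeneous ![1, 1, b] f d) (m : Fin 3 →₀ ℕ) (hm : coeff m f ≠ 0) :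
    m 1 + b * m 2 ≤ d ∧ m = mk3 (d - m 1 - b * m 2) (m 1) (m 2) := by
  have h := hf hm
  rw [Finsupp.weight_apply, Finsupp.sum_fintype _ _ (by simp), Fin.sum_univ_three] at h
  simp at h
  rw [mul_comm] at h
  refine ⟨by omega, ?_⟩
  ext i
  fin_cases i
  · simp [mk3]; omega
  · simp [mk3]
  · simp [mk3]

theorem aux_eval {b d : ℕ} (hb : 0 < b) {f : MvPolynomial (Fin 3) F}
    (hf : IsWeightedHomogeneous ![1, 1, b] f d) (x y z : F) :
    eval ![x, y, z] f = ∑ j ∈ Finset.range (d+1), ∑ i ∈ Finset.range (d+1),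
      cf F b d f i j * x ^ (d - i - b * j) * y ^ i * z ^ j := by
  classical
  rw [MvPolynomial.eval_eq', ← Finset.sum_product']
  set S := ((Finset.range (d+1)) ×ˢ (Finset.range (d+1))).filter (fun p => p.2 + b * p.1 ≤ d)
    with hS
  have h1 : f.support ⊆ S.image (fun p => mk3 (d - p.2 - b * p.1) p.2 p.1) := by
    intro m hm
    obtain ⟨h1, h2⟩ := aux_supp F hf m (by simpa using hm)
    rw [Finset.mem_image]
    refine ⟨(m 2, m 1), ?_, h2.symm⟩
    have : m 2 ≤ b * m 2 := Nat.le_mul_of_pos_left _ hb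
    simp [hS]
    omega
  rw [Finset.sum_subset h1, Finset.sum_image, hS, Finset.sum_filter]
  · apply Finset.sum_congr rfl
    rintro ⟨j, i⟩ -
    simp only [cf]
    split_ifs
    · simp [Fin.prod_univ_three, mk3]; ring
    · simp
  · rintro ⟨a, a'⟩ - ⟨c, c'⟩ - hh
    have h1 := DFunLike.congr_fun hh 1
    have h2 := DFunLike.congr_fun hh 2
    simp [mk3] at h1 h2
    simp [h1, h2]
  · intro m _ hm
    rw [MvPolynomial.notMem_support_iff.1 hm, zero_mul]

theorem aux_cf_ne {b d : ℕ} {f : MvPolynomial (Fin 3) F}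
    (hf : IsWeightedHomogeneous ![1, 1, b] f d) (h0 : f ≠ 0) :
    ∃ i j, cf F b d f i j ≠ 0 := by
  obtain ⟨m, hm⟩ := MvPolynomial.ne_zero_iff.1 h0
  obtain ⟨h1, h2⟩ := aux_supp F hf m hm
  refine ⟨m 1, m 2, ?_⟩
  rw [cf, if_pos h1, ← h2]
  exact hm

theorem aux_cf_le {b d : ℕ} {f : MvPolynomial (Fin 3) F} {i j : ℕ} (h : cf F b d f i j ≠ 0) :
    i + b * j ≤ d := by
  by_contra h'
  exact h (by rw [cf, if_neg h'])

/-- coefficient polynomials -/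
def Pj (b d : ℕ) (f : MvPolynomial (Fin 3) F) (j : ℕ) : Polynomial F :=
  ∑ i ∈ Finset.range (d+1), Polynomial.C (cf F b d f i j) * Polynomial.X ^ i

theorem Pj_coeff (b d : ℕ) (f : MvPolynomial (Fin 3) F) (j i : ℕ) :
    (Pj F b d f j).coeff i = cf F b d f i j := by
  simp only [Pj, Polynomial.finset_sum_coeff, Polynomial.coeff_C_mul, Polynomial.coeff_X_pow]
  simp
  intro h
  by_contra h'
  have := aux_cf_le F (Ne.symm h')
  omega

/-- the polynomial at infinity -/
def Gp (b d : ℕ) (f : MvPolynomial (Fin 3) F) : Polynomial F :=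
  ∑ j ∈ Finset.range (d+1), Polynomial.C (cf F b d f (d - b * j) j) * Polynomial.X ^ (d - b * j)

theorem aux_zero_term {b d : ℕ} (f : MvPolynomial (Fin 3) F) (y : F) (j : ℕ) :
    ∑ i ∈ Finset.range (d+1), cf F b d f i j * 0 ^ (d - i - b * j) * y ^ i =
      cf F b d f (d - b * j) j * y ^ (d - b * j) := by
  rw [Finset.sum_eq_single (d - b * j)]
  · by_cases h : cf F b d f (d - b * j) j = 0
    · simp [h]
    · have := aux_cf_le F h
      rw [show d - (d - b * j) - b * j = 0 by omega]
      simp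
  · intro i _ hi
    by_cases h : cf F b d f i j = 0
    · simp [h]
    · have := aux_cf_le F h
      rw [zero_pow (by omega)]
      simp
  · intro h
    simp at h

theorem aux_inf {b d : ℕ} (hb : 0 < b) {f : MvPolynomial (Fin 3) F}
    (hf : IsWeightedHomogeneous ![1, 1, b] f d) (y : F) :
    eval ![0, y, 1] f = (Gp F b d f).eval y := by
  rw [aux_eval F hb hf, Gp, Polynomial.eval_finset_sum]
  apply Finset.sum_congr rfl
  intro j _
  simp only [one_pow, mul_one]
  rw [aux_zero_term]
  simp

theorem aux_inf2 {b d : ℕ} (hb : 0 < b) {f : MvPolynomial (Fin 3) F}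
    (hf : IsWeightedHomogeneous ![1, 1, b] f d) :
    eval ![0, 1, 0] f = cf F b d f d 0 := by
  rw [aux_eval F hb hf, Finset.sum_eq_single 0]
  · have := aux_zero_term F (b := b) (d := d) f 1 0
    simpa using this
  · intro j _ hj
    simp [zero_pow hj]
  · simp

theorem Gp_coeff {b d : ℕ} (hb : 0 < b) (f : MvPolynomial (Fin 3) F) (j : ℕ) (hj : b * j ≤ d) :
    (Gp F b d f).coeff (d - b * j) = cf F b d f (d - b * j) j := by
  simp only [Gp, Polynomial.finset_sum_coeff, Polynomial.coeff_C_mul, Polynomial.coeff_X_pow]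
  rw [Finset.sum_eq_single j]
  · simp
  · intro k _ hk
    by_cases h : cf F b d f (d - b * k) k = 0
    · simp [h]
    · have := aux_cf_le F h
      have h2 : b * j ≠ b * k := fun h => hk (Nat.eq_of_mul_eq_mul_left hb h).symm
      rw [if_neg (by omega), mul_zero]
  · intro h
    have : j ≤ b * j := Nat.le_mul_of_pos_left _ hb
    simp at h
    omega

open Classical in
theorem aux_inf_count {b d : ℕ} (hb : 0 < b) (hd0 : 0 < d) (hdq : d < Fintype.card F)
    {f : MvPolynomial (Fin 3) F}
    (hf : IsWeightedHomogeneous ![1, 1, b] f d) (hG : Gp F b d f ≠ 0) :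
    Fintype.card F - d + 1 ≤ (Finset.univ.filter fun a : F => eval ![0, a, 1] f ≠ 0).card +
      (if eval ![0, 1, 0] f ≠ 0 then 1 else 0) := by
  simp only [aux_inf F hb hf, aux_inf2 F hb hf]
  split_ifs with h
  · have := aux_roots F _ hG d (by
      apply Polynomial.natDegree_sum_le_of_forall_le
      intro j _
      exact (Polynomial.natDegree_C_mul_X_pow_le _ _).trans (by omega))
    omega
  · have := aux_roots F _ hG (d-1) (by
      apply Polynomial.natDegree_sum_le_of_forall_le
      intro j _
      rcases Nat.eq_zero_or_pos j with rfl | hj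
      · simp at h
        simp [h]
      · have : 0 < b * j := Nat.mul_pos hb hj
        exact (Polynomial.natDegree_C_mul_X_pow_le _ _).trans (by omega))
    omega

theorem aux_main {b d : ℕ} (hb : 0 < b) (hd0 : 0 < d) (hdq : d < Fintype.card F)
    {f : MvPolynomial (Fin 3) F}
    (hf : IsWeightedHomogeneous ![1, 1, b] f d) (h0 : f ≠ 0)
    (hyp : 2 ≤ b ∨ eval ![0, 0, 1] f = 0 ∨ ∀ p, eval ![0, p, 1] f ≠ 0) :
    Fintype.card F * (Fintype.card F - d + 1) ≤ {P ∈ T F | eval P f ≠ 0}.ncard := by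
  classical
  rw [aux_count]
  set q := Fintype.card F
  have hex : ∃ j, j ≤ d ∧ Pj F b d f j ≠ 0 := by
    obtain ⟨i, j, h⟩ := aux_cf_ne F hf h0
    have h1 := aux_cf_le F h
    have : j ≤ b * j := Nat.le_mul_of_pos_left _ hb
    refine ⟨j, by omega, fun h2 => h ?_⟩
    rw [← Pj_coeff, h2, Polynomial.coeff_zero]
  obtain ⟨j₀, hj₀, hj₀'⟩ := hex
  set J := Nat.findGreatest (fun j => Pj F b d f j ≠ 0) d with hJdef
  have hJ : Pj F b d f J ≠ 0 :=
    Nat.findGreatest_spec (P := fun j => Pj F b d f j ≠ 0) hj₀ hj₀'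
  have hJd : J ≤ d := Nat.findGreatest_le d
  have hmax : ∀ j, J < j → ∀ i, cf F b d f i j = 0 := by
    intro j hj i
    by_contra h
    have h1 := aux_cf_le F h
    have h2 : j ≤ b * j := Nat.le_mul_of_pos_left _ hb
    have h3 := Nat.findGreatest_is_greatest hj (by omega)
    simp only [not_not] at h3
    apply h
    rw [← Pj_coeff, h3, Polynomial.coeff_zero]
  have hbJ : b * J ≤ d := by
    by_contra h
    apply hJ
    ext i
    rw [Pj_coeff, cf, if_neg (by omega), Polynomial.coeff_zero]
  have haff : ∀ x y : F, eval ![1, x, y] f =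
      ∑ j ∈ Finset.range (J+1), (Pj F b d f j).eval x * y ^ j := by
    intro x y
    rw [aux_eval F hb hf]
    symm
    rw [Finset.sum_subset (s₂ := Finset.range (d+1))]
    · apply Finset.sum_congr rfl
      intro j _
      rw [Pj, Polynomial.eval_finset_sum, Finset.sum_mul]
      simp
    · intro j hj
      simp at hj ⊢
      omega
    · intro j _ hj
      have : Pj F b d f j = 0 := by
        ext i
        rw [Pj_coeff, hmax j (by simpa using hj), Polynomial.coeff_zero]
      simp [this]
  have hA : ∀ e, (Pj F b d f J).natDegree ≤ e → (q - e) * (q - J) ≤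
      (Finset.univ.filter fun a : F × F => eval ![1, a.1, a.2] f ≠ 0).card := by
    intro e he
    simp only [haff]
    exact aux_affine F (Pj F b d f) J e hJ he
  have hdeg : (Pj F b d f J).natDegree ≤ d - b * J := by
    rw [Polynomial.natDegree_le_iff_coeff_eq_zero]
    intro i hi
    rw [Pj_coeff, cf, if_neg (by omega)]
  by_cases hG : Gp F b d f = 0
  · have hz : cf F b d f (d - b * J) J = 0 := by
      rw [← Gp_coeff F hb f J hbJ, hG, Polynomial.coeff_zero]
    have hlt : (Pj F b d f J).natDegree < d - b * J := by
      refine lt_of_le_of_ne hdeg fun h => ?_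
      rw [← Pj_coeff, ← h] at hz
      exact hJ (Polynomial.leadingCoeff_eq_zero.1 hz)
    exact (aux_arith1 hb hdq (by omega) (hA _ le_rfl)).trans (Nat.le_add_right _ _)
  have hI := aux_inf_count F hb hd0 hdq hf hG
  have hA' := hA _ hdeg
  have key : q ≤ (Finset.univ.filter fun a : F => eval ![0, a, 1] f ≠ 0).card +
      (if eval ![0, 1, 0] f ≠ 0 then 1 else 0) → q * (q - d) ≤
      (Finset.univ.filter fun a : F × F => eval ![1, a.1, a.2] f ≠ 0).card →
      q * (q - d + 1) ≤ (Finset.univ.filter fun a : F × F => eval ![1, a.1, a.2] f ≠ 0).card +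
      ((Finset.univ.filter fun a : F => eval ![0, a, 1] f ≠ 0).card +
      (if eval ![0, 1, 0] f ≠ 0 then 1 else 0)) := by
    intro h1 h2
    rw [mul_add, mul_one]
    exact add_le_add h2 h1
  rcases Nat.eq_zero_or_pos J with hJ0 | hJ0
  · rw [hJ0] at hA' hmax
    have hGe : Gp F b d f = Polynomial.C (cf F b d f d 0) * Polynomial.X ^ d := by
      rw [Gp, Finset.sum_eq_single 0]
      · simp
      · intro j _ hj
        rw [hmax j (Nat.pos_of_ne_zero hj)]
        simp
      · simp
    have hc : cf F b d f d 0 ≠ 0 := by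
      intro h
      rw [h] at hGe
      exact hG (by simpa using hGe)
    apply key
    · simp only [aux_inf F hb hf, aux_inf2 F hb hf, hGe]
      rw [if_pos hc]
      have : (Finset.univ.filter fun a : F =>
          Polynomial.eval a (Polynomial.C (cf F b d f d 0) * Polynomial.X ^ d) ≠ 0) =
          Finset.univ.erase 0 := by
        ext a
        simp [hc, hd0.ne']
      rw [this, Finset.card_erase_of_mem (Finset.mem_univ _), Finset.card_univ]
      omega
    · rw [mul_comm]
      simpa using hA'
  by_cases hcase : 2 ≤ b ∨ J < d
  · exact aux_arith hb hdq hbJ hA' hI hJ0 hcase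
  · have hJe : J = d := by omega
    have hb1 : b = 1 := by omega
    subst hb1
    rcases hyp with h | h | h
    · omega
    · exfalso
      rw [aux_inf F hb hf, ← Polynomial.coeff_zero_eq_eval_zero] at h
      have h2 := Gp_coeff F (b := 1) (d := d) hb f d (one_mul d).le
      simp only [one_mul, Nat.sub_self] at h2
      rw [h] at h2
      apply hJ
      ext i
      rw [Pj_coeff, Polynomial.coeff_zero]
      by_contra h3
      have := aux_cf_le F h3
      have hi : i = 0 := by omega
      rw [hi, hJe] at h3
      exact h3 h2.symm
    · apply key
      · simp only [ne_eq, h, not_false_eq_true, Finset.filter_true, Finset.card_univ]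
        exact Nat.le_add_right _ _
      · simpa [hJe] using hA'

theorem aux_shift {d : ℕ} (p : F) {f : MvPolynomial (Fin 3) F}
    (hf : IsWeightedHomogeneous ![1, 1, 1] f d) :
    ∃ g : MvPolynomial (Fin 3) F, IsWeightedHomogeneous ![1, 1, 1] g d ∧
      ∀ y : Fin 3 → F, eval y g = eval ![y 0, y 1 + p * y 2, y 2] f := by
  have hw : (![1, 1, 1] : Fin 3 → ℕ) = 1 := by
    ext i; fin_cases i <;> rfl
  rw [hw] at hf ⊢
  refine ⟨aeval ![X 0, X 1 + C p * X 2, X 2] f, ?_, ?_⟩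
  · have := IsHomogeneous.aeval (n := 1) (show f.IsHomogeneous d from hf)
      (![X 0, X 1 + C p * X 2, X 2] : Fin 3 → MvPolynomial (Fin 3) F) (by
        intro i
        fin_cases i
        · exact isHomogeneous_X _ _
        · exact (isHomogeneous_X _ _).add (by
            simpa using (isHomogeneous_C (Fin 3) p).mul (isHomogeneous_X F (2 : Fin 3)))
        · exact isHomogeneous_X _ _)
    rw [one_mul] at this
    exact this
  · intro y
    rw [← MvPolynomial.coe_aeval_eq_eval, ← MvPolynomial.coe_aeval_eq_eval]
    simp only [RingHom.coe_coe]
    rw [← AlgHom.comp_apply, MvPolynomial.comp_aeval]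
    congr 2
    ext i
    fin_cases i <;> simp

theorem aux_lower {b d : ℕ} (hb : 0 < b) (hd0 : 0 < d) (hdq : d < Fintype.card F)
    {f : MvPolynomial (Fin 3) F}
    (hf : IsWeightedHomogeneous ![1, 1, b] f d) (h0 : ∃ P ∈ T F, eval P f ≠ 0) :
    Fintype.card F * (Fintype.card F - d + 1) ≤ {P ∈ T F | eval P f ≠ 0}.ncard := by
  obtain ⟨P, hP, hPf⟩ := h0
  have hf0 : f ≠ 0 := by
    rintro rfl
    simp at hPf
  by_cases hyp : 2 ≤ b ∨ eval ![0, 0, 1] f = 0 ∨ ∀ p, eval ![0, p, 1] f ≠ 0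
  · exact aux_main F hb hd0 hdq hf hf0 hyp
  push Not at hyp
  obtain ⟨h1, -, p, hp⟩ := hyp
  have hb1 : b = 1 := by omega
  subst hb1
  obtain ⟨g, hg, hge⟩ := aux_shift F p hf
  have hg0 : g ≠ 0 := by
    rintro rfl
    have := hge ![P 0, P 1 - p * P 2, P 2]
    simp at this
    apply hPf
    rw [this]
    congr 2
    ext i; fin_cases i <;> rfl
  have hm := aux_main F hb hd0 hdq hg hg0 (Or.inr (Or.inl (by rw [hge]; simpa using hp)))
  refine hm.trans ?_
  apply Set.ncard_le_ncard_of_injOn (fun y => ![y 0, y 1 + p * y 2, y 2])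
  · rintro y ⟨hy, hy'⟩
    refine ⟨?_, by rwa [hge] at hy'⟩
    rcases hy with (h | h) | h
    · exact Or.inl (Or.inl (by simpa using h))
    · exact Or.inl (Or.inr (by simpa using h))
    · rw [Set.mem_singleton_iff] at h
      subst h
      exact Or.inr (by simp)
  · intro y _ z _ h
    have e0 := congrFun h 0
    have e1 := congrFun h 1
    have e2 := congrFun h 2
    simp at e0 e1 e2
    rw [e2] at e1
    ext i
    fin_cases i
    · exact e0
    · exact add_right_cancel e1
    · exact e2

theorem aux_upper (b d : ℕ) (hd0 : 0 < d) (hdq : d < Fintype.card F) :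
    ∃ f : MvPolynomial (Fin 3) F,
        IsWeightedHomogeneous ![1, 1, b] f d ∧ (∃ P ∈ T F, eval P f ≠ 0) ∧
        Fintype.card F * (Fintype.card F - d + 1) = {P ∈ T F | eval P f ≠ 0}.ncard := by
  classical
  obtain ⟨A, -, hA⟩ := Finset.exists_subset_card_eq (s := (Finset.univ : Finset F)) (n := d)
    (by rw [Finset.card_univ]; omega)
  have hev : ∀ y : Fin 3 → F, eval y (∏ a ∈ A, (X 1 - C a * X 0 : MvPolynomial (Fin 3) F)) =
      ∏ a ∈ A, (y 1 - a * y 0) := by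
    intro y
    simp [map_prod]
  refine ⟨∏ a ∈ A, (X 1 - C a * X 0), ?_, ⟨![0, 1, 0], Or.inr rfl, ?_⟩, ?_⟩
  · have := IsWeightedHomogeneous.prod A
      (fun a => (X 1 - C a * X 0 : MvPolynomial (Fin 3) F)) (fun _ => 1) (w := ![1, 1, b]) (by
        intro a _
        have h1 : IsWeightedHomogeneous ![1, 1, b] (X 1 : MvPolynomial (Fin 3) F) 1 :=
          isWeightedHomogeneous_X F ![1, 1, b] 1
        have h2 : IsWeightedHomogeneous ![1, 1, b] (C a * X 0 : MvPolynomial (Fin 3) F) 1 := by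
          have := (isWeightedHomogeneous_C ![1, 1, b] a).mul
            (isWeightedHomogeneous_X F ![1, 1, b] (0 : Fin 3))
          simpa using this
        exact (weightedHomogeneousSubmodule F ![1, 1, b] 1).sub_mem h1 h2)
    simpa [hA] using this
  · rw [hev]; simp
  · rw [aux_count]
    simp only [hev]
    have e1 : (Finset.univ.filter fun a : F × F =>
        ∏ c ∈ A, ((![1, a.1, a.2] : Fin 3 → F) 1 - c * (![1, a.1, a.2] : Fin 3 → F) 0) ≠ 0) =
        Aᶜ ×ˢ Finset.univ := by
      ext ⟨a, y⟩
      simp only [Finset.mem_filter, Finset.mem_univ, true_and, Finset.mem_product,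
        Finset.mem_compl, and_true, Finset.prod_ne_zero_iff]
      simp only [Matrix.cons_val_one, Matrix.cons_val_zero, mul_one, ne_eq, sub_eq_zero]
      constructor
      · intro h h'
        exact h a h' rfl
      · rintro h c hc rfl
        exact h hc
    have e2 : (Finset.univ.filter fun a : F =>
        ∏ c ∈ A, ((![0, a, 1] : Fin 3 → F) 1 - c * (![0, a, 1] : Fin 3 → F) 0) ≠ 0) =
        Finset.univ.erase 0 := by
      ext a
      simp [hA, hd0.ne']
    rw [e1, e2, if_pos (by simp), Finset.card_product, Finset.card_compl, hA,
      Finset.card_erase_of_mem (Finset.mem_univ _), Finset.card_univ,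
      Nat.sub_add_cancel (by omega), mul_add, mul_one, mul_comm]

/-- Theorem (minimum distance of `C_{d,Y}` for `0 < d < q`): the minimum of
`|{P ∈ T : F(P) ≠ 0}|` over weighted-homogeneous `F ∈ S_d` with nonzero evaluation
vector is exactly `q(q − d + 1)`. -/
theorem min_distance_P11b_d_lt_q (q : ℕ) (hq : q = Fintype.card F)
    (b : ℕ) (hb : 0 < b) (d : ℕ) (hd0 : 0 < d) (hdq : d < q) :
    IsLeast {n : ℕ | ∃ f : MvPolynomial (Fin 3) F,
        IsWeightedHomogeneous ![1, 1, b] f d ∧ (∃ P ∈ T F, eval P f ≠ 0) ∧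
        n = {P ∈ T F | eval P f ≠ 0}.ncard} (q * (q - d + 1)) := by
  subst hq
  refine ⟨aux_upper F b d hd0 hdq, ?_⟩
  rintro n ⟨f, hf, h0, rfl⟩
  exact aux_lower F hb hd0 hdq hf h0

end
end

section
/- Let q be a prime power and let b be a positive integer. Let d be a natural number written as d = q + kb + r with k, r ∈ ℕ and 0 ≤ r < b. If k ≥ q − 1, then the minimum distance of the code C_{d,Y} on Y = P(1,1,b)(F_q) equals 1; that is, there exists a weighted-homogeneous F ∈ S_d whose evaluation vector (F(P))_{P ∈ T} is nonzero and which vanishes at exactly q² + q of the q² + q + 1 points of T. -/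
open MvPolynomial

noncomputable section

variable (F : Type) [Field F] [Fintype F]

theorem T_ncard : (T F).ncard = Fintype.card F ^ 2 + Fintype.card F + 1 := by
  classical
  let g : (F × F) ⊕ (F ⊕ Unit) → (Fin 3 → F) :=
    Sum.elim (fun p => ![1, p.1, p.2]) (Sum.elim (fun y => ![0, y, 1]) (fun _ => ![0, 1, 0]))
  have hg : Function.Injective g := by
    rintro (⟨a, b⟩ | a | a) (⟨c, d⟩ | c | c) h <;>
    · have h0 := congrFun h 0
      have h1 := congrFun h 1
      have h2 := congrFun h 2
      simp [g] at h0 h1 h2 <;> simp_all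
  have hT : T F = Set.range g := by
    ext y
    constructor
    · rintro ((h | ⟨h, h'⟩) | h)
      · refine ⟨Sum.inl (y 1, y 2), ?_⟩
        ext i
        have h : y 0 = 1 := h
        fin_cases i <;> simp [g, h]
      · refine ⟨Sum.inr (Sum.inl (y 1)), ?_⟩
        ext i
        fin_cases i <;> simp [g, h, h']
      · exact ⟨Sum.inr (Sum.inr ()), h.symm⟩
    · rintro ⟨(⟨a, b⟩ | a | a), rfl⟩ <;> simp [g, T]
  rw [hT, ← Set.image_univ, Set.ncard_image_of_injective _ hg, Set.ncard_univ,
    Nat.card_eq_fintype_card]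
  simp
  ring

/-- There is a form of degree `d` whose only nonzero in `T` is `(1,0,0)`. -/
theorem exists_indicator (b d k r : ℕ)
    (hd : d = Fintype.card F + k * b + r) (hk : Fintype.card F - 1 ≤ k) :
    ∃ f : MvPolynomial (Fin 3) F, IsWeightedHomogeneous ![1, 1, b] f d ∧
      ∀ P ∈ T F, (eval P f ≠ 0 ↔ P = ![1, 0, 0]) := by
  have hq : 1 < Fintype.card F := Fintype.one_lt_card
  obtain ⟨m, hm⟩ : ∃ m, Fintype.card F = m + 1 := ⟨Fintype.card F - 1, by omega⟩
  have hm0 : m ≠ 0 := by omega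
  obtain ⟨l, rfl⟩ : ∃ l, k = m + l := ⟨k - m, by omega⟩
  have hpow : ∀ a : F, a ≠ 0 → a ^ m = 1 := fun a ha => by
    have := FiniteField.pow_card_sub_one_eq_one a ha
    simpa [hm] using this
  have hX : ∀ i, IsWeightedHomogeneous ![1, 1, b] (X i : MvPolynomial (Fin 3) F)
      ((![1, 1, b] : Fin 3 → ℕ) i) := fun i => isWeightedHomogeneous_X F _ i
  refine ⟨X 0 ^ (1 + l * b + r) * ((X 1 ^ m - X 0 ^ m) * (X 2 ^ m - X 0 ^ (m * b))), ?_, ?_⟩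
  · have e0 : ∀ n, IsWeightedHomogeneous ![1, 1, b] (X 0 ^ n : MvPolynomial (Fin 3) F) n := by
      intro n
      simpa using (hX 0).pow n
    have e1 : IsWeightedHomogeneous ![1, 1, b] (X 1 ^ m : MvPolynomial (Fin 3) F) m := by
      simpa using (hX 1).pow m
    have e2 : IsWeightedHomogeneous ![1, 1, b] (X 2 ^ m : MvPolynomial (Fin 3) F) (m * b) := by
      simpa using (hX 2).pow m
    have a1 := (weightedHomogeneousSubmodule F ![1, 1, b] m).sub_mem e1 (e0 m)
    have a2 := (weightedHomogeneousSubmodule F ![1, 1, b] (m * b)).sub_mem e2 (e0 (m * b))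
    have := (e0 (1 + l * b + r)).mul (IsWeightedHomogeneous.mul a1 a2)
    convert this using 1
    rw [hd, hm]; ring
  · rintro P ((h | ⟨h, h'⟩) | h)
    · have h : P 0 = 1 := h
      have hP : P = ![1, 0, 0] ↔ P 1 = 0 ∧ P 2 = 0 := by
        constructor
        · rintro rfl; simp
        · rintro ⟨h1, h2⟩
          ext i
          fin_cases i <;> simp [h, h1, h2]
      rw [hP]
      by_cases h1 : P 1 = 0 <;> by_cases h2 : P 2 = 0 <;> simp [h, h1, h2, hm0, hpow]
    · have : P ≠ ![1, 0, 0] := by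
        rintro rfl; simp at h
      have e : 1 + l * b + r ≠ 0 := by omega
      simp [h, this, zero_pow e]
    · obtain rfl : P = ![0, 1, 0] := h
      have : (![0, 1, 0] : Fin 3 → F) ≠ ![1, 0, 0] := by
        intro h; simpa using congrFun h 0
      have e : 1 + l * b + r ≠ 0 := by omega
      simp [this, zero_pow e]

/-- Theorem (minimum distance `1` for large degree): if `d = q + kb + r` with
`0 ≤ r < b` and `k ≥ q − 1`, then the minimum distance of `C_{d,Y}` equals `1`;
indeed there is a weighted-homogeneous `F ∈ S_d` with nonzero evaluation vector
vanishing at exactly `q² + q` of the `q² + q + 1` points of `T`. -/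
theorem min_distance_one_P11b (q : ℕ) (hq : q = Fintype.card F)
    (b : ℕ) (hb : 0 < b) (d k r : ℕ)
    (hd : d = q + k * b + r) (hr : r < b) (hk : q - 1 ≤ k) :
    IsLeast {n : ℕ | ∃ f : MvPolynomial (Fin 3) F,
        IsWeightedHomogeneous ![1, 1, b] f d ∧ (∃ P ∈ T F, eval P f ≠ 0) ∧
        n = {P ∈ T F | eval P f ≠ 0}.ncard} 1 ∧
    ∃ f : MvPolynomial (Fin 3) F, IsWeightedHomogeneous ![1, 1, b] f d ∧
      (∃ P ∈ T F, eval P f ≠ 0) ∧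
      {P ∈ T F | eval P f = 0}.ncard = q ^ 2 + q := by
  subst hq
  obtain ⟨f, hf, hP⟩ := exists_indicator F b d k r hd hk
  have hmem : (![1, 0, 0] : Fin 3 → F) ∈ T F := by simp [T]
  have hne : ∃ P ∈ T F, eval P f ≠ 0 := ⟨_, hmem, (hP _ hmem).2 rfl⟩
  have hset : {P ∈ T F | eval P f ≠ 0} = {![1, 0, 0]} := by
    ext P
    simp only [Set.mem_setOf_eq, Set.mem_singleton_iff]
    constructor
    · rintro ⟨h, h'⟩; exact (hP P h).1 h'
    · rintro rfl; exact ⟨hmem, (hP _ hmem).2 rfl⟩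
  refine ⟨⟨⟨f, hf, hne, ?_⟩, ?_⟩, f, hf, hne, ?_⟩
  · rw [hset, Set.ncard_singleton]
  · rintro n ⟨g, -, ⟨P, hPT, hPg⟩, rfl⟩
    exact (Set.ncard_pos (Set.toFinite _)).2 ⟨P, hPT, hPg⟩
  · have hset' : {P ∈ T F | eval P f = 0} = T F \ {![1, 0, 0]} := by
      rw [← hset]
      ext P
      simp only [Set.mem_setOf_eq, Set.mem_diff]
      tauto
    rw [hset', Set.ncard_diff_singleton_of_mem hmem, T_ncard]
    rfl

end
end

section
/- Let q be a prime power and let b be a positive integer, and let d be a natural number with b ≤ d < q. Then every nonzero weighted-homogeneous polynomial F ∈ S_d (weights deg x₁ = deg x₂ = 1, deg x₃ = b) satisfies |{P ∈ T : F(P) = 0}| ≤ qd + 1; that is, F vanishes at at most qd + 1 of the q² + q + 1 representative points of P(1,1,b)(F_q). -/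
open MvPolynomial

noncomputable section

variable (F : Type) [Field F] [Fintype F]

open MvPolynomial in
/-- Number of affine zeros. -/
def cntA (F : Type) [Field F] [Fintype F] (f : MvPolynomial (Fin 3) F) : ℕ := by
  classical
  exact (Finset.univ.filter fun p : F × F => eval ![1, p.1, p.2] f = 0).card

/-- Number of zeros `(0, y, 1)`. -/
def cntI (F : Type) [Field F] [Fintype F] (f : MvPolynomial (Fin 3) F) : ℕ := by
  classical
  exact (Finset.univ.filter fun y : F => eval ![0, y, 1] f = 0).card

/-- Number of zeros among `(0, 1, 0)`. -/
def cntE (F : Type) [Field F] [Fintype F] (f : MvPolynomial (Fin 3) F) : ℕ := by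
  classical
  exact if eval ![0, 1, 0] f = 0 then 1 else 0

theorem ncard_le_cnt (F : Type) [Field F] [Fintype F] (f : MvPolynomial (Fin 3) F) :
    {P ∈ T F | eval P f = 0}.ncard ≤ cntA F f + cntI F f + cntE F f := by
  classical
  have hsub : {P ∈ T F | eval P f = 0} ⊆
      (((Finset.univ.filter fun p : F × F => eval ![1, p.1, p.2] f = 0).image
          (fun p => (![1, p.1, p.2] : Fin 3 → F)) ∪
        (Finset.univ.filter fun y : F => eval ![0, y, 1] f = 0).image
          (fun y => (![0, y, 1] : Fin 3 → F)) ∪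
        (if eval ![0, 1, 0] f = 0 then {(![0, 1, 0] : Fin 3 → F)} else ∅) :
          Finset (Fin 3 → F)) : Set (Fin 3 → F)) := by
    rintro P ⟨hP, h0⟩
    rcases hP with (hP | hP) | hP
    · have e : P = ![1, P 1, P 2] := by
        ext i; fin_cases i <;> simp_all
      rw [Finset.mem_coe, Finset.mem_union, Finset.mem_union]
      left; left
      rw [Finset.mem_image]
      exact ⟨(P 1, P 2), by simp only [Finset.mem_filter, Finset.mem_univ, true_and]; rw [← e]; exact h0, e.symm⟩
    · have e : P = ![0, P 1, 1] := by
        ext i; fin_cases i <;> simp_all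
      rw [Finset.mem_coe, Finset.mem_union, Finset.mem_union]
      left; right
      rw [Finset.mem_image]
      exact ⟨P 1, by simp only [Finset.mem_filter, Finset.mem_univ, true_and]; rw [← e]; exact h0, e.symm⟩
    · have e : P = ![0, 1, 0] := hP
      subst e
      rw [Finset.mem_coe, Finset.mem_union]
      right
      rw [if_pos h0]
      simp
  refine (Set.ncard_le_ncard hsub (Finset.finite_toSet _)).trans ?_
  rw [Set.ncard_coe_finset]
  refine (Finset.card_union_le _ _).trans ?_
  refine Nat.add_le_add ((Finset.card_union_le _ _).trans
    (Nat.add_le_add Finset.card_image_le Finset.card_image_le)) ?_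
  unfold cntE
  split_ifs <;> simp

/-- Zero count for bivariate polynomials. -/
theorem affine_bound (F : Type) [Field F] [Fintype F] [DecidableEq F]
    (P : Polynomial (Polynomial F)) (hP : P ≠ 0) (m s : ℕ) (hm : P.natDegree = m)
    (hmq : m ≤ Fintype.card F) (hs : P.leadingCoeff.natDegree ≤ s) :
    (Finset.univ.filter fun p : F × F =>
      ((P.map (Polynomial.evalRingHom p.1)).eval p.2) = 0).card
      ≤ Fintype.card F * m + s * (Fintype.card F - m) := by
  have hl : P.leadingCoeff ≠ 0 := Polynomial.leadingCoeff_ne_zero.mpr hP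
  have hfib : (Finset.univ.filter fun p : F × F =>
      ((P.map (Polynomial.evalRingHom p.1)).eval p.2) = 0).card
      = ∑ y : F, (Finset.univ.filter fun z : F =>
        ((P.map (Polynomial.evalRingHom y)).eval z) = 0).card := by
    simp only [Finset.card_filter]
    rw [Fintype.sum_prod_type]
  rw [hfib]
  have hb : ∀ y : F, (Finset.univ.filter fun z : F =>
        ((P.map (Polynomial.evalRingHom y)).eval z) = 0).card ≤
        m + if P.leadingCoeff.eval y = 0 then Fintype.card F - m else 0 := by
    intro y
    split_ifs with h
    · refine (Finset.card_le_univ _).trans ?_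
      omega
    · have hne : P.map (Polynomial.evalRingHom y) ≠ 0 := by
        intro h0
        apply h
        have := congrArg (fun r => r.coeff P.natDegree) h0
        simpa [Polynomial.coeff_map] using this
      have : (Finset.univ.filter fun z : F =>
        ((P.map (Polynomial.evalRingHom y)).eval z) = 0) ⊆
          (P.map (Polynomial.evalRingHom y)).roots.toFinset := by
        intro z hz
        simp only [Finset.mem_filter, Finset.mem_univ, true_and] at hz
        simp only [Multiset.mem_toFinset]
        rw [Polynomial.mem_roots hne]
        exact hz
      refine (Finset.card_le_card this).trans ((Multiset.toFinset_card_le _).trans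
        ((Polynomial.card_roots' _).trans (Polynomial.natDegree_map_le.trans ?_)))
      omega
  refine (Finset.sum_le_sum fun y _ => hb y).trans ?_
  rw [Finset.sum_add_distrib, Finset.sum_const, Finset.card_univ, smul_eq_mul]
  refine Nat.add_le_add_left ?_ _
  rw [← Finset.sum_filter, Finset.sum_const, smul_eq_mul]
  refine Nat.mul_le_mul_right _ (le_trans ?_ hs)
  have : (Finset.univ.filter fun y : F => P.leadingCoeff.eval y = 0) ⊆
      P.leadingCoeff.roots.toFinset := by
    intro z hz
    simp only [Finset.mem_filter, Finset.mem_univ, true_and] at hz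
    simp only [Multiset.mem_toFinset]
    rw [Polynomial.mem_roots hl]
    exact hz
  exact (Finset.card_le_card this).trans ((Multiset.toFinset_card_le _).trans
        (Polynomial.card_roots' _))

/-- Dehomogenization at `x₁ = 1`. -/
def polyP (F : Type) [Field F] (f : MvPolynomial (Fin 3) F) : Polynomial (Polynomial F) :=
  ∑ s ∈ f.support, Polynomial.monomial (s 2) (Polynomial.monomial (s 1) (f.coeff s))

/-- Restriction to `x₁ = 0`, `x₃ = 1`. -/
def polyG (F : Type) [Field F] (f : MvPolynomial (Fin 3) F) : Polynomial F :=
  ∑ s ∈ f.support, if s 0 = 0 then Polynomial.monomial (s 1) (f.coeff s) else 0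

theorem polyP_eval (F : Type) [Field F] (f : MvPolynomial (Fin 3) F) (y z : F) :
    ((polyP F f).map (Polynomial.evalRingHom y)).eval z = eval ![1, y, z] f := by
  rw [MvPolynomial.eval_eq']
  simp [polyP, Polynomial.map_sum, Polynomial.eval_finsetSum, Fin.prod_univ_three, mul_assoc]

theorem polyG_eval (F : Type) [Field F] (f : MvPolynomial (Fin 3) F) (y : F) :
    (polyG F f).eval y = eval ![0, y, 1] f := by
  rw [MvPolynomial.eval_eq']
  simp only [polyG, Polynomial.eval_finsetSum, Fin.prod_univ_three]
  refine Finset.sum_congr rfl fun s _ => ?_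
  by_cases h : s 0 = 0 <;> simp [h]

theorem wt (F : Type) [Field F] (f : MvPolynomial (Fin 3) F) (b d : ℕ)
    (hf : IsWeightedHomogeneous ![1, 1, b] f d) (s : Fin 3 →₀ ℕ) (hs : s ∈ f.support) :
    s 0 + s 1 + b * s 2 = d := by
  have := hf (MvPolynomial.mem_support_iff.mp hs)
  rw [Finsupp.weight_apply, Finsupp.sum_fintype _ _ (by simp)] at this
  simp [Fin.sum_univ_three] at this
  rw [mul_comm b]; exact this

theorem s_ext (s t : Fin 3 →₀ ℕ) (h0 : s 0 = t 0) (h1 : s 1 = t 1) (h2 : s 2 = t 2) : s = t := by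
  ext i; fin_cases i <;> assumption

theorem polyP_coeff (F : Type) [Field F] (f : MvPolynomial (Fin 3) F) (b d : ℕ)
    (hf : IsWeightedHomogeneous ![1, 1, b] f d) (s : Fin 3 →₀ ℕ) (hs : s ∈ f.support) :
    ((polyP F f).coeff (s 2)).coeff (s 1) = f.coeff s := by
  classical
  simp only [polyP, Polynomial.finsetSum_coeff, Polynomial.coeff_monomial]
  rw [Finset.sum_eq_single s]
  · simp
  · intro t ht hts
    split_ifs with h2
    · rw [Polynomial.coeff_monomial, if_neg]
      intro h1
      apply hts
      have a1 := wt F f b d hf s hs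
      have a2 := wt F f b d hf t ht
      rw [← h1, ← h2] at a1
      exact s_ext _ _ (by omega) h1 h2
    · simp
  · exact fun h => absurd hs h

theorem polyP_ex (F : Type) [Field F] (f : MvPolynomial (Fin 3) F) (i j : ℕ)
    (h : ((polyP F f).coeff j).coeff i ≠ 0) : ∃ s ∈ f.support, s 1 = i ∧ s 2 = j := by
  classical
  simp only [polyP, Polynomial.finsetSum_coeff, Polynomial.coeff_monomial] at h
  obtain ⟨s, hs, h⟩ := Finset.exists_ne_zero_of_sum_ne_zero h
  refine ⟨s, hs, ?_⟩
  split_ifs at h with h2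
  · rw [Polynomial.coeff_monomial] at h
    split_ifs at h with h1
    · exact ⟨h1, h2⟩
    · exact absurd rfl h
  · simp at h

theorem polyG_coeff (F : Type) [Field F] (f : MvPolynomial (Fin 3) F) (b d : ℕ) (hb : 0 < b)
    (hf : IsWeightedHomogeneous ![1, 1, b] f d) (s : Fin 3 →₀ ℕ) (hs : s ∈ f.support)
    (hs0 : s 0 = 0) :
    (polyG F f).coeff (s 1) = f.coeff s := by
  classical
  simp only [polyG, Polynomial.finsetSum_coeff]
  rw [Finset.sum_eq_single s]
  · simp [hs0]
  · intro t ht hts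
    split_ifs with h2
    · rw [Polynomial.coeff_monomial, if_neg]
      intro h1
      apply hts
      have a1 := wt F f b d hf s hs
      have a2 := wt F f b d hf t ht
      refine s_ext _ _ (by omega) h1 (Nat.eq_of_mul_eq_mul_left hb (by omega))
    · simp
  · exact fun h => absurd hs h

theorem polyG_ex (F : Type) [Field F] (f : MvPolynomial (Fin 3) F) (i : ℕ)
    (h : (polyG F f).coeff i ≠ 0) : ∃ s ∈ f.support, s 0 = 0 ∧ s 1 = i := by
  classical
  simp only [polyG, Polynomial.finsetSum_coeff] at h
  obtain ⟨s, hs, h⟩ := Finset.exists_ne_zero_of_sum_ne_zero h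
  refine ⟨s, hs, ?_⟩
  split_ifs at h with h2
  · rw [Polynomial.coeff_monomial] at h
    split_ifs at h with h1
    · exact ⟨h2, h1⟩
    · exact absurd rfl h
  · simp at h

theorem eval_E (F : Type) [Field F] (f : MvPolynomial (Fin 3) F) (b d : ℕ)
    (hf : IsWeightedHomogeneous ![1, 1, b] f d) (s : Fin 3 →₀ ℕ) (hs : s ∈ f.support)
    (hs0 : s 0 = 0) (hs2 : s 2 = 0) :
    eval ![0, 1, 0] f ≠ 0 := by
  rw [MvPolynomial.eval_eq', Finset.sum_eq_single s]
  · simpa [Fin.prod_univ_three, hs0, hs2] using hs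
  · intro t ht hts
    by_cases h0 : t 0 = 0
    · by_cases h2 : t 2 = 0
      · exfalso
        apply hts
        have a1 := wt F f b d hf s hs
        have a2 := wt F f b d hf t ht
        rw [hs2] at a1
        rw [h2] at a2
        exact s_ext _ _ (by omega) (by omega) (by omega)
      · simp [Fin.prod_univ_three, h2]
    · simp [Fin.prod_univ_three, h0]
  · exact fun h => absurd hs h

/-- Affine bound with parameters. -/
theorem cntA_le (F : Type) [Field F] [Fintype F] (f : MvPolynomial (Fin 3) F) (hf0 : f ≠ 0)
    (b d e : ℕ) (hb : 0 < b) (hf : IsWeightedHomogeneous ![1, 1, b] f d)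
    (he : ∀ s ∈ f.support, s 1 + b * s 2 ≤ e) (heq : e < Fintype.card F) :
    (polyP F f).natDegree * b ≤ e ∧
    cntA F f ≤ Fintype.card F * (polyP F f).natDegree +
      (e - b * (polyP F f).natDegree) * (Fintype.card F - (polyP F f).natDegree) := by
  classical
  obtain ⟨s, hs⟩ := MvPolynomial.support_nonempty.mpr hf0
  have hP : polyP F f ≠ 0 := by
    intro h
    have := polyP_coeff F f b d hf s hs
    rw [h] at this
    simp at this
    exact MvPolynomial.mem_support_iff.mp hs this.symm
  have hl : (polyP F f).leadingCoeff ≠ 0 := Polynomial.leadingCoeff_ne_zero.mpr hP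
  have hll : (polyP F f).leadingCoeff.leadingCoeff ≠ 0 := Polynomial.leadingCoeff_ne_zero.mpr hl
  obtain ⟨t, ht, h1, h2⟩ := polyP_ex F f _ _ hll
  have := he t ht
  rw [h1, h2] at this
  have hm : (polyP F f).natDegree ≤ b * (polyP F f).natDegree := Nat.le_mul_of_pos_left _ hb
  refine ⟨by rw [mul_comm]; omega, ?_⟩
  have key := affine_bound F (polyP F f) hP _ (e - b * (polyP F f).natDegree) rfl
    (by omega) (by omega)
  unfold cntA
  simp only [polyP_eval] at key
  convert key

theorem cntI_le (F : Type) [Field F] [Fintype F] (f : MvPolynomial (Fin 3) F)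
    (hg : polyG F f ≠ 0) : cntI F f ≤ (polyG F f).natDegree := by
  classical
  have : (Finset.univ.filter fun y : F => eval ![0, y, 1] f = 0) ⊆
      (polyG F f).roots.toFinset := by
    intro z hz
    simp only [Finset.mem_filter, Finset.mem_univ, true_and] at hz
    simp only [Multiset.mem_toFinset]
    rw [Polynomial.mem_roots hg, Polynomial.IsRoot, polyG_eval]
    exact hz
  unfold cntI
  refine le_trans ?_ ((Finset.card_le_card this).trans ((Multiset.toFinset_card_le _).trans
        (Polynomial.card_roots' _)))
  exact le_of_eq (by congr)

theorem cntA_le' (F : Type) [Field F] [Fintype F] (f : MvPolynomial (Fin 3) F) (hf0 : f ≠ 0)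
    (b d e : ℕ) (hb : 0 < b) (hf : IsWeightedHomogeneous ![1, 1, b] f d)
    (he : ∀ s ∈ f.support, s 1 + b * s 2 ≤ e) (heq : e < Fintype.card F) :
    cntA F f ≤ Fintype.card F * e := by
  obtain ⟨h1, h2⟩ := cntA_le F f hf0 b d e hb hf he heq
  refine h2.trans ?_
  generalize (polyP F f).natDegree = m at *
  have hm : m ≤ b * m := Nat.le_mul_of_pos_left _ hb
  rw [mul_comm] at h1
  calc Fintype.card F * m + (e - b * m) * (Fintype.card F - m)
      ≤ Fintype.card F * m + (e - m) * Fintype.card F :=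
        Nat.add_le_add_left (Nat.mul_le_mul (by omega) (by omega)) _
    _ = Fintype.card F * e := by
        rw [mul_comm (e - m), ← mul_add]; congr 1; omega

theorem cntE_le (F : Type) [Field F] [Fintype F] (f : MvPolynomial (Fin 3) F) :
    cntE F f ≤ 1 := by
  unfold cntE; split_ifs <;> simp

theorem core (F : Type) [Field F] [Fintype F] (f : MvPolynomial (Fin 3) F) (hf0 : f ≠ 0)
    (b d : ℕ) (hb : 0 < b) (hbd : b ≤ d) (hdq : d < Fintype.card F)
    (hf : IsWeightedHomogeneous ![1, 1, b] f d)
    (hyp : 2 ≤ b ∨ eval ![0, 0, 1] f = 0) :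
    cntA F f + cntI F f + cntE F f ≤ Fintype.card F * d + 1 := by
  classical
  have hw := wt F f b d hf
  by_cases hg : polyG F f = 0
  · have hpos : ∀ s ∈ f.support, s 1 + b * s 2 ≤ d - 1 := by
      intro s hs
      by_cases h0 : s 0 = 0
      · exfalso
        have := polyG_coeff F f b d hb hf s hs h0
        rw [hg] at this
        simp at this
        exact MvPolynomial.mem_support_iff.mp hs this.symm
      · have := hw s hs
        omega
    have hA := cntA_le' F f hf0 b d (d - 1) hb hf hpos (by omega)
    have hI : cntI F f ≤ Fintype.card F := by
      unfold cntI
      exact Finset.card_le_univ _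
    have hE := cntE_le F f
    obtain ⟨k, rfl⟩ : ∃ k, d = k + 1 := ⟨d - 1, by omega⟩
    rw [Nat.add_sub_cancel] at hA
    rw [mul_add]
    omega
  · have hall : ∀ s ∈ f.support, s 1 + b * s 2 ≤ d := by
      intro s hs
      have := hw s hs
      omega
    obtain ⟨hm, hA⟩ := cntA_le F f hf0 b d d hb hf hall hdq
    have hA' := cntA_le' F f hf0 b d d hb hf hall hdq
    have hI := cntI_le F f hg
    obtain ⟨s, hs, hs0, hs1⟩ := polyG_ex F f _ (Polynomial.leadingCoeff_ne_zero.mpr hg)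
    have hsw := hw s hs
    rcases Nat.eq_zero_or_pos (polyP F f).natDegree with m0 | mpos
    · have hz : ∀ t ∈ f.support, t 2 = 0 := by
        intro t ht
        by_contra h
        have h1 := polyP_coeff F f b d hf t ht
        rw [Polynomial.coeff_eq_zero_of_natDegree_lt (p := polyP F f) (n := t 2) (by omega)] at h1
        simp at h1
        exact MvPolynomial.mem_support_iff.mp ht h1.symm
      have hE : cntE F f = 0 := by
        unfold cntE
        rw [if_neg (eval_E F f b d hf s hs hs0 (hz s hs))]
      have hI1 : cntI F f ≤ 1 := by
        unfold cntI
        rw [Finset.card_le_one_iff_subset_singleton]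
        refine ⟨0, fun y hy => ?_⟩
        simp only [Finset.mem_filter, Finset.mem_univ, true_and] at hy
        rw [Finset.mem_singleton]
        rw [MvPolynomial.eval_eq', Finset.sum_eq_single s] at hy
        · simp only [Fin.prod_univ_three] at hy
          have hc := MvPolynomial.mem_support_iff.mp hs
          simp [hs0, hc] at hy
          exact hy.1
        · intro t ht hts
          have h0 : t 0 ≠ 0 := by
            intro h0
            apply hts
            have a2 := hw t ht
            have e1 := hz t ht
            have e2 := hz s hs
            rw [e1] at a2
            rw [e2] at hsw
            exact s_ext _ _ (by omega) (by omega) (by omega)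
          simp [Fin.prod_univ_three, h0]
        · exact fun h => absurd hs h
      omega
    · have hinf : cntI F f + cntE F f ≤ d := by
        by_cases he : eval ![0, 1, 0] f = 0
        · have : s 2 ≠ 0 := fun h => eval_E F f b d hf s hs hs0 h he
          have : b ≤ b * s 2 := Nat.le_mul_of_pos_right _ (by omega)
          have := cntE_le F f
          omega
        · have : cntE F f = 0 := by unfold cntE; rw [if_neg he]
          omega
      by_cases hb2 : 2 ≤ b
      · clear hA'
        generalize (polyP F f).natDegree = m at *
        generalize Fintype.card F = q at *
        have h2 : m + m ≤ b * m := by nlinarith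
        rw [mul_comm] at hm
        have : (d - b * m) * (q - m) ≤ (d - (m + 1)) * q :=
          Nat.mul_le_mul (by omega) (by omega)
        have e : q * m + (d - (m + 1)) * q + q = q * d := by
          obtain ⟨k, rfl⟩ : ∃ k, d = m + 1 + k := ⟨d - (m+1), by omega⟩
          rw [Nat.add_sub_cancel_left]; ring
        omega
      · have hb1 : b = 1 := by omega
        subst hb1
        have h001 : eval ![0, 0, 1] f = 0 := by
          rcases hyp with h | h
          · omega
          · exact h
        have hlt : (polyP F f).natDegree < d := by
          by_contra hge
          have hmd : (polyP F f).natDegree = d := by omega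
          have hP : polyP F f ≠ 0 := by
            intro h; rw [h] at mpos; simp at mpos
          have hll : (polyP F f).leadingCoeff.leadingCoeff ≠ 0 :=
            Polynomial.leadingCoeff_ne_zero.mpr (Polynomial.leadingCoeff_ne_zero.mpr hP)
          obtain ⟨t, ht, t1, t2⟩ := polyP_ex F f _ _ hll
          have htw := hw t ht
          have hG := polyG_coeff F f 1 d hb hf t ht (by omega)
          have ht1 : t 1 = 0 := by omega
          rw [ht1, Polynomial.coeff_zero_eq_eval_zero, polyG_eval, h001] at hG
          exact MvPolynomial.mem_support_iff.mp ht hG.symm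
        generalize (polyP F f).natDegree = m at *
        generalize Fintype.card F = q at *
        rw [one_mul] at hA
        obtain ⟨k, rfl⟩ : ∃ k, d = m + 1 + k := ⟨d - (m+1), by omega⟩
        obtain ⟨r, rfl⟩ : ∃ r, q = m + r := ⟨q - m, by omega⟩
        have e1 : m + 1 + k - m = k + 1 := by omega
        have e2 : m + r - m = r := by omega
        rw [e1, e2] at hA
        obtain ⟨m', rfl⟩ : ∃ m', m = m' + 1 := ⟨m - 1, by omega⟩
        nlinarith [Nat.zero_le (m' * k)]

/-- The shear `x₂ ↦ x₂ + a x₃`. -/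
def shear (F : Type) [Field F] (a : F) (f : MvPolynomial (Fin 3) F) : MvPolynomial (Fin 3) F :=
  aeval (![X 0, X 1 + C a * X 2, X 2] : Fin 3 → MvPolynomial (Fin 3) F) f

theorem shear_eval (F : Type) [Field F] (a : F) (f : MvPolynomial (Fin 3) F) (x y z : F) :
    eval ![x, y, z] (shear F a f) = eval ![x, y + a * z, z] f := by
  unfold shear
  rw [← MvPolynomial.coe_aeval_eq_eval, ← MvPolynomial.coe_aeval_eq_eval]
  simp only [RingHom.coe_coe]
  rw [← AlgHom.comp_apply]
  congr 1
  ext i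
  fin_cases i <;> simp

theorem shear_ne (F : Type) [Field F] (a : F) (f : MvPolynomial (Fin 3) F) (hf : f ≠ 0) :
    shear F a f ≠ 0 := by
  intro h
  apply hf
  have h2 : shear F (-a) (shear F a f) = f := by
    unfold shear
    rw [← AlgHom.comp_apply]
    conv_rhs => rw [← AlgHom.id_apply (R := F) f]
    congr 1
    ext i : 1
    fin_cases i <;> simp
  rw [← h2, h]
  simp [shear]

theorem shear_hom (F : Type) [Field F] (a : F) (f : MvPolynomial (Fin 3) F) (d : ℕ)
    (hf : IsWeightedHomogeneous ![1, 1, 1] f d) :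
    IsWeightedHomogeneous ![1, 1, 1] (shear F a f) d := by
  have e : (![1, 1, 1] : Fin 3 → ℕ) = 1 := by
    ext i; fin_cases i <;> rfl
  rw [e] at hf ⊢
  have hf' : IsHomogeneous f d := hf
  have := hf'.aeval (n := 1) (![X 0, X 1 + C a * X 2, X 2] : Fin 3 → MvPolynomial (Fin 3) F) (by
    intro i
    fin_cases i
    · exact isHomogeneous_X _ _
    · refine (isHomogeneous_X _ _).add ?_
      simpa using (isHomogeneous_C (Fin 3) a).mul (isHomogeneous_X F (2 : Fin 3))
    · exact isHomogeneous_X _ _)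
  rw [one_mul] at this
  exact this

theorem shear_cnt (F : Type) [Field F] [Fintype F] (a : F) (f : MvPolynomial (Fin 3) F) :
    cntA F (shear F a f) = cntA F f ∧ cntI F (shear F a f) = cntI F f ∧
      cntE F (shear F a f) = cntE F f := by
  classical
  refine ⟨?_, ?_, ?_⟩
  · unfold cntA
    simp only [shear_eval]
    refine Finset.card_bij' (fun p _ => (p.1 + a * p.2, p.2)) (fun p _ => (p.1 - a * p.2, p.2))
      ?_ ?_ ?_ ?_ <;> simp
  · unfold cntI
    simp only [shear_eval]
    refine Finset.card_bij' (fun p _ => p + a) (fun p _ => p - a)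
      ?_ ?_ ?_ ?_ <;> simp
  · unfold cntE
    simp only [shear_eval]
    simp

/-- Theorem (zero count for `b ≤ d < q`): every nonzero weighted-homogeneous `F ∈ S_d`
vanishes at at most `qd + 1` of the `q² + q + 1` points of `T`. -/
theorem zeros_upper_bound_P11b_b_le_d_lt_q (q : ℕ) (hq : q = Fintype.card F)
    (b : ℕ) (hb : 0 < b) (d : ℕ) (hbd : b ≤ d) (hdq : d < q) :
    ∀ f : MvPolynomial (Fin 3) F, f ≠ 0 → IsWeightedHomogeneous ![1, 1, b] f d →
      {P ∈ T F | eval P f = 0}.ncard ≤ q * d + 1 := by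
  intro f hf0 hf
  subst hq
  refine (ncard_le_cnt F f).trans ?_
  by_cases hb2 : 2 ≤ b
  · exact core F f hf0 b d hb hbd hdq hf (Or.inl hb2)
  · have hb1 : b = 1 := by omega
    subst hb1
    by_cases hI : cntI F f = 0
    · have hA := cntA_le' F f hf0 1 d d hb hf
        (fun s hs => by have := wt F f 1 d hf s hs; omega) hdq
      have := cntE_le F f
      omega
    · unfold cntI at hI
      obtain ⟨a, ha⟩ := Finset.card_pos.mp (Nat.pos_of_ne_zero hI)
      simp only [Finset.mem_filter, Finset.mem_univ, true_and] at ha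
      obtain ⟨h1, h2, h3⟩ := shear_cnt F a f
      rw [← h1, ← h2, ← h3]
      refine core F (shear F a f) (shear_ne F a f hf0) 1 d hb hbd hdq (shear_hom F a f d hf)
        (Or.inr ?_)
      rw [shear_eval]
      simpa using ha

end
end
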